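/- arXiv:2508.08485 — 5 statements merged into one kernel-verified Lean document; each statement's English description precedes it below -/
import Mathlib

section
/- Let θ̂ ∈ ℝ^n be fixed. Assume the positive integers m_1, …, m_n are pairwise distinct and satisfy, for all indices i, j, k ∈ {1,…,n}: m_i ≠ m_j + m_k, and m_i ≠ |m_j − m_k| whenever j ≠ k. Then for every i ∈ {1,…,n}, (1/T) ∫₀^T (2/a_i) sin(ω_i t) · y(θ̂ + S(t)) dt = (H (θ̂ − θ*))_i; that is, demodulating the perturbed quadratic map with the signal (2/a_i) sin(ω_i t) and averaging over one period recovers exactly the i-th component of the gradient H(θ̂ − θ*) of y at θ̂. -/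
open Real Matrix

theorem integral_cos_int_frequency {T : ℝ} (hT : T ≠ 0) (k : ℤ) :
    ∫ t in (0:ℝ)..T, cos (2 * π * k / T * t) = if k = 0 then T else 0 := by
  split_ifs with hk
  · simp [hk]
  · have hc : 2 * π * k / T ≠ 0 := by
      have := pi_ne_zero
      positivity
    rw [intervalIntegral.integral_comp_mul_left _ hc, integral_cos,
      div_mul_cancel₀ _ hT, mul_zero, sin_zero,
      show 2 * π * (k : ℝ) = ((2 * k : ℤ) : ℝ) * π by push_cast; ring, sin_int_mul_pi]
    simp

theorem integral_sin_mul_sin_nat_frequency {T : ℝ} (hT : T ≠ 0) {p : ℕ} (hp : 0 < p) (q : ℕ) :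
    ∫ t in (0:ℝ)..T, sin (2 * π * p / T * t) * sin (2 * π * q / T * t)
      = if p = q then T / 2 else 0 := by
  have key : ∀ t : ℝ, sin (2 * π * p / T * t) * sin (2 * π * q / T * t)
      = (cos (2 * π * ((p - q : ℤ) : ℝ) / T * t)
          - cos (2 * π * ((p + q : ℤ) : ℝ) / T * t)) / 2 := by
    intro t
    have h₁ : 2 * π * ((p - q : ℤ) : ℝ) / T * t
        = 2 * π * p / T * t - 2 * π * q / T * t := by push_cast; ring
    have h₂ : 2 * π * ((p + q : ℤ) : ℝ) / T * t
        = 2 * π * p / T * t + 2 * π * q / T * t := by push_cast; ring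
    rw [h₁, h₂, cos_sub, cos_add]
    ring
  simp_rw [key]
  rw [intervalIntegral.integral_div, intervalIntegral.integral_sub
      (Continuous.intervalIntegrable (by fun_prop) _ _)
      (Continuous.intervalIntegrable (by fun_prop) _ _),
    integral_cos_int_frequency hT, integral_cos_int_frequency hT,
    if_neg (show (p + q : ℤ) ≠ 0 by omega)]
  by_cases h : p = q
  · simp [h]
  · rw [if_neg h, if_neg (by omega)]
    simp

theorem integral_eq_zero_of_reflect_eq_neg {T : ℝ} {f : ℝ → ℝ} (hf : ∀ t, f (T - t) = -f t) :
    ∫ t in (0:ℝ)..T, f t = 0 := by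
  have h := intervalIntegral.integral_comp_sub_left (a := 0) (b := T) f T
  simp only [hf, intervalIntegral.integral_neg, sub_self, sub_zero] at h
  linarith

theorem sin_nat_frequency_reflect {T : ℝ} (hT : T ≠ 0) (p : ℕ) (t : ℝ) :
    sin (2 * π * p / T * (T - t)) = -sin (2 * π * p / T * t) := by
  rw [show 2 * π * p / T * (T - t) = p * (2 * π) - 2 * π * p / T * t by field_simp,
    sin_nat_mul_two_pi_sub]

theorem Matrix.IsSymm.quadratic_add {ι : Type*} [Fintype ι] {H : Matrix ι ι ℝ} (hH : H.IsSymm)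
    (d s : ι → ℝ) :
    (d + s) ⬝ᵥ H *ᵥ (d + s) = d ⬝ᵥ H *ᵥ d + 2 * (H *ᵥ d ⬝ᵥ s) + s ⬝ᵥ H *ᵥ s := by
  have h : d ⬝ᵥ H *ᵥ s = H *ᵥ d ⬝ᵥ s := by
    rw [dotProduct_mulVec, ← mulVec_transpose, hH.eq]
  rw [mulVec_add, dotProduct_add, add_dotProduct, add_dotProduct, h,
    dotProduct_comm s (H *ᵥ d)]
  ring

/-- Demodulating the perturbed quadratic map `y` with the signal `(2/aᵢ) sin(ωᵢ t)`
and averaging over one period recovers exactly the `i`-th component of the gradient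
`H (θ̂ − θ*)`. -/
theorem gradient_demodulation_exact
    (n : ℕ) (Qstar : ℝ) (θstar : Fin n → ℝ) (H : Matrix (Fin n) (Fin n) ℝ)
    (hH : H.IsSymm)
    (T : ℝ) (hT : 0 < T)
    (m : Fin n → ℕ) (hmpos : ∀ i, 0 < m i)
    (hm_distinct : Function.Injective m)
    (hm_sum : ∀ i j k : Fin n, m i ≠ m j + m k)
    (hm_diff : ∀ i j k : Fin n, j ≠ k → (m i : ℤ) ≠ |(m j : ℤ) - (m k : ℤ)|)
    (a : Fin n → ℝ) (ha : ∀ i, a i ≠ 0)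
    (ω : Fin n → ℝ) (hω : ∀ i, ω i = 2 * π * (m i : ℝ) / T)
    (S : ℝ → Fin n → ℝ) (hS : ∀ t i, S t i = a i * Real.sin (ω i * t))
    (y : (Fin n → ℝ) → ℝ)
    (hy : ∀ θ, y θ = Qstar + (1 / 2) * ((θ - θstar) ⬝ᵥ H.mulVec (θ - θstar)))
    (θhat : Fin n → ℝ) (i : Fin n) :
    (1 / T) * ∫ t in (0:ℝ)..T, (2 / a i) * Real.sin (ω i * t) * y (θhat + S t)
      = H.mulVec (θhat - θstar) i := by
  have hT0 := hT.ne'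
  have hω' : ω = fun j => 2 * π * (m j : ℝ) / T := funext hω
  subst hω'
  set d := θhat - θstar with hd
  have hScont : Continuous S := by
    refine continuous_pi fun j => ?_
    simp_rw [hS]
    fun_prop
  have hSneg : ∀ t, S (T - t) = -S t := by
    intro t
    ext j
    rw [Pi.neg_apply, hS, hS, sin_nat_frequency_reflect hT0, mul_neg]
  let g : ℝ → ℝ := fun t => 2 / a i * sin (2 * π * m i / T * t) *
    (Qstar + 1 / 2 * (d ⬝ᵥ H *ᵥ d + S t ⬝ᵥ H *ᵥ S t))
  have hg : Continuous g := by
    have hq : Continuous fun t => S t ⬝ᵥ H *ᵥ S t :=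
      hScont.dotProduct (continuous_const.matrix_mulVec hScont)
    fun_prop
  have hg0 : ∫ t in (0:ℝ)..T, g t = 0 := by
    refine integral_eq_zero_of_reflect_eq_neg fun t => ?_
    simp only [g, hSneg, sin_nat_frequency_reflect hT0, mulVec_neg, neg_dotProduct_neg]
    ring
  have hsplit : ∀ t, 2 / a i * sin (2 * π * m i / T * t) * y (θhat + S t)
      = g t + ∑ j, 2 / a i * (H *ᵥ d) j * a j *
          (sin (2 * π * m i / T * t) * sin (2 * π * m j / T * t)) := by
    intro t
    have hsum : ∑ j, 2 / a i * (H *ᵥ d) j * a j *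
          (sin (2 * π * m i / T * t) * sin (2 * π * m j / T * t))
        = 2 / a i * sin (2 * π * m i / T * t) * (H *ᵥ d ⬝ᵥ S t) := by
      rw [dotProduct, Finset.mul_sum]
      refine Finset.sum_congr rfl fun j _ => ?_
      rw [hS]
      ring
    rw [hsum, hy, show θhat + S t - θstar = d + S t by rw [hd]; abel, hH.quadratic_add]
    simp only [g]
    ring
  simp_rw [hsplit]
  rw [intervalIntegral.integral_add (hg.intervalIntegrable _ _)
      (Continuous.intervalIntegrable (by fun_prop) _ _), hg0,
    intervalIntegral.integral_finsetSum
      fun j _ => Continuous.intervalIntegrable (by fun_prop) _ _]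
  simp_rw [intervalIntegral.integral_const_mul,
    integral_sin_mul_sin_nat_frequency hT0 (hmpos i), hm_distinct.eq_iff]
  have hai := ha i
  simp only [mul_ite, mul_zero, Finset.sum_ite_eq, Finset.mem_univ, if_true]
  field_simp
  ring
end

section
/- Let θ̂ ∈ ℝ^n be fixed. Assume the positive integers m_1, …, m_n are pairwise distinct and that, for a fixed index i and all indices j ≠ k in {1,…,n}: 2 m_i ≠ m_j + m_k and 2 m_i ≠ |m_j − m_k|. Then (1/T) ∫₀^T (−8/a_i²) cos(2 ω_i t) · y(θ̂ + S(t)) dt = H_{ii}; that is, demodulating the perturbed quadratic map with the signal N_{ii}(t) = −(8/a_i²) cos(2 ω_i t) and averaging over one period recovers exactly the (i,i) diagonal entry of the Hessian H, independently of θ̂. -/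
open Real Matrix

theorem integral_sin_int_harmonic {T : ℝ} (hT : T ≠ 0) (p : ℤ) :
    ∫ t in (0:ℝ)..T, Real.sin (p * (2 * π / T) * t) = 0 := by
  rcases eq_or_ne p 0 with rfl | hp
  · simp
  have hc : (p : ℝ) * (2 * π / T) ≠ 0 := by
    have := Real.pi_ne_zero
    have : (p : ℝ) ≠ 0 := Int.cast_ne_zero.mpr hp
    positivity
  have hpT : (p : ℝ) * (2 * π / T) * T = p * (2 * π) := by field_simp
  rw [intervalIntegral.integral_comp_mul_left (fun x => Real.sin x) hc, integral_sin, hpT,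
    Real.cos_int_mul_two_pi]
  simp

theorem integral_cos_int_harmonic {T : ℝ} (hT : T ≠ 0) (p : ℤ) :
    ∫ t in (0:ℝ)..T, Real.cos (p * (2 * π / T) * t) = if p = 0 then T else 0 := by
  split_ifs with hp
  · simp [hp]
  have hc : (p : ℝ) * (2 * π / T) ≠ 0 := by
    have := Real.pi_ne_zero
    have : (p : ℝ) ≠ 0 := Int.cast_ne_zero.mpr hp
    positivity
  have hpT : (p : ℝ) * (2 * π / T) * T = ((2 * p : ℤ) : ℝ) * π := by
    push_cast; field_simp
  rw [intervalIntegral.integral_comp_mul_left (fun x => Real.cos x) hc, integral_cos, hpT,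
    Real.sin_int_mul_pi]
  simp

theorem integral_cos_mul_sin_int_harmonic {T : ℝ} (hT : T ≠ 0) (q p : ℤ) :
    ∫ t in (0:ℝ)..T, Real.cos (q * (2 * π / T) * t) * Real.sin (p * (2 * π / T) * t) = 0 := by
  have h : ∀ t : ℝ, Real.cos (q * (2 * π / T) * t) * Real.sin (p * (2 * π / T) * t)
      = 1 / 2 * (Real.sin ((p + q : ℤ) * (2 * π / T) * t)
        + Real.sin ((p - q : ℤ) * (2 * π / T) * t)) := by
    intro t
    push_cast
    simp only [add_mul, sub_mul, Real.sin_add, Real.sin_sub]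
    ring
  simp only [h]
  rw [intervalIntegral.integral_const_mul, intervalIntegral.integral_add,
    integral_sin_int_harmonic hT, integral_sin_int_harmonic hT]
  · simp
  all_goals exact Continuous.intervalIntegrable (by fun_prop) _ _

theorem integral_cos_mul_sin_mul_sin_int_harmonic {T : ℝ} (hT : T ≠ 0) (q p r : ℤ) :
    ∫ t in (0:ℝ)..T, Real.cos (q * (2 * π / T) * t) *
        (Real.sin (p * (2 * π / T) * t) * Real.sin (r * (2 * π / T) * t)) =
      1 / 4 * (((if q + p - r = 0 then T else 0) + (if q - p + r = 0 then T else 0)) -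
        ((if q + p + r = 0 then T else 0) + (if q - p - r = 0 then T else 0))) := by
  have h : ∀ t : ℝ, Real.cos (q * (2 * π / T) * t) *
        (Real.sin (p * (2 * π / T) * t) * Real.sin (r * (2 * π / T) * t))
      = 1 / 4 * ((Real.cos ((q + p - r : ℤ) * (2 * π / T) * t)
          + Real.cos ((q - p + r : ℤ) * (2 * π / T) * t))
        - (Real.cos ((q + p + r : ℤ) * (2 * π / T) * t)
          + Real.cos ((q - p - r : ℤ) * (2 * π / T) * t))) := by
    intro t
    push_cast
    simp only [add_mul, sub_mul, Real.sin_add, Real.sin_sub, Real.cos_add, Real.cos_sub]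
    ring
  simp only [h]
  rw [intervalIntegral.integral_const_mul, intervalIntegral.integral_sub,
    intervalIntegral.integral_add, intervalIntegral.integral_add]
  · simp only [integral_cos_int_harmonic hT]
  all_goals exact Continuous.intervalIntegrable (by fun_prop) _ _

theorem integral_cos_mul_affine_sin_mul_affine_sin {T : ℝ} (hT : T ≠ 0) {q : ℤ} (hq : q ≠ 0)
    (p r : ℤ) (b c d e : ℝ) :
    ∫ t in (0:ℝ)..T, Real.cos (q * (2 * π / T) * t) *
        ((b + c * Real.sin (p * (2 * π / T) * t)) * (d + e * Real.sin (r * (2 * π / T) * t))) =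
      c * e * ∫ t in (0:ℝ)..T, Real.cos (q * (2 * π / T) * t) *
        (Real.sin (p * (2 * π / T) * t) * Real.sin (r * (2 * π / T) * t)) := by
  have h : ∀ t : ℝ, Real.cos (q * (2 * π / T) * t) *
        ((b + c * Real.sin (p * (2 * π / T) * t)) * (d + e * Real.sin (r * (2 * π / T) * t)))
      = (b * d * Real.cos (q * (2 * π / T) * t)
          + c * d * (Real.cos (q * (2 * π / T) * t) * Real.sin (p * (2 * π / T) * t)))
        + (b * e * (Real.cos (q * (2 * π / T) * t) * Real.sin (r * (2 * π / T) * t))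
          + c * e * (Real.cos (q * (2 * π / T) * t) *
            (Real.sin (p * (2 * π / T) * t) * Real.sin (r * (2 * π / T) * t)))) := by
    intro t
    ring
  simp only [h]
  rw [intervalIntegral.integral_add, intervalIntegral.integral_add,
    intervalIntegral.integral_add]
  · simp only [intervalIntegral.integral_const_mul, integral_cos_int_harmonic hT,
      integral_cos_mul_sin_int_harmonic hT, if_neg hq]
    ring
  all_goals exact Continuous.intervalIntegrable (by fun_prop) _ _

/-- Demodulating the perturbed quadratic map with the signal `Nᵢᵢ(t) = −(8/aᵢ²) cos(2ωᵢ t)`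
and averaging over one period recovers exactly the `(i,i)` diagonal entry of the
Hessian `H`, independently of `θ̂`. -/
theorem hessian_diagonal_demodulation_exact
    (n : ℕ) (Qstar : ℝ) (θstar : Fin n → ℝ) (H : Matrix (Fin n) (Fin n) ℝ)
    (hH : H.IsSymm)
    (T : ℝ) (hT : 0 < T)
    (m : Fin n → ℕ) (hmpos : ∀ i, 0 < m i)
    (hm_distinct : Function.Injective m)
    (a : Fin n → ℝ) (ha : ∀ i, a i ≠ 0)
    (ω : Fin n → ℝ) (hω : ∀ i, ω i = 2 * π * (m i : ℝ) / T)
    (S : ℝ → Fin n → ℝ) (hS : ∀ t i, S t i = a i * Real.sin (ω i * t))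
    (y : (Fin n → ℝ) → ℝ)
    (hy : ∀ θ, y θ = Qstar + (1 / 2) * ((θ - θstar) ⬝ᵥ H.mulVec (θ - θstar)))
    (θhat : Fin n → ℝ) (i : Fin n)
    (hm_sum : ∀ j k : Fin n, j ≠ k → 2 * m i ≠ m j + m k)
    (hm_diff : ∀ j k : Fin n, j ≠ k → (2 * m i : ℤ) ≠ |(m j : ℤ) - (m k : ℤ)|) :
    (1 / T) * ∫ t in (0:ℝ)..T, (-8 / (a i) ^ 2) * Real.cos (2 * ω i * t) * y (θhat + S t)
      = H i i := by
  have hT0 : T ≠ 0 := hT.ne'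
  have hq : (2 * m i : ℤ) ≠ 0 := by have := hmpos i; omega
  have hωm : ∀ j, ω j = ((m j : ℤ) : ℝ) * (2 * π / T) := by
    intro j; rw [hω j]; push_cast; ring
  have hω2 : 2 * ω i = ((2 * m i : ℤ) : ℝ) * (2 * π / T) := by
    rw [hω i]; push_cast; ring
  have h_integrand : ∀ t, (-8 / (a i) ^ 2) * Real.cos (2 * ω i * t) * y (θhat + S t)
      = (-8 / (a i) ^ 2) * (Qstar * Real.cos ((2 * m i : ℤ) * (2 * π / T) * t)
        + ∑ j, ∑ k, 1 / 2 * H j k * (Real.cos ((2 * m i : ℤ) * (2 * π / T) * t) *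
          (((θhat j - θstar j) + a j * Real.sin ((m j : ℤ) * (2 * π / T) * t)) *
           ((θhat k - θstar k) + a k * Real.sin ((m k : ℤ) * (2 * π / T) * t))))) := by
    intro t
    rw [hy, hω2, mul_assoc, mul_add, mul_comm _ Qstar]
    congr 2
    simp only [dotProduct, mulVec, Finset.mul_sum, Pi.sub_apply, Pi.add_apply, hS, hωm]
    refine Finset.sum_congr rfl fun j _ => Finset.sum_congr rfl fun k _ => ?_
    ring
  have hterm : ∀ j k, ∫ t in (0:ℝ)..T, Real.cos ((2 * m i : ℤ) * (2 * π / T) * t) *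
      (Real.sin ((m j : ℤ) * (2 * π / T) * t) * Real.sin ((m k : ℤ) * (2 * π / T) * t))
      = if j = i ∧ k = i then -T / 4 else 0 := by
    intro j k
    rw [integral_cos_mul_sin_mul_sin_int_harmonic hT0]
    have hi := hmpos i
    by_cases hjk : j = k
    · subst hjk
      by_cases hji : j = i
      · subst hji
        rw [if_neg (by omega), if_neg (by omega), if_neg (by omega), if_pos (by omega),
          if_pos ⟨rfl, rfl⟩]
        ring
      · have hne : m j ≠ m i := fun h => hji (hm_distinct h)
        rw [if_neg (by omega), if_neg (by omega), if_neg (by omega), if_neg (by omega),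
          if_neg (by tauto)]
        ring
    · have hsum := hm_sum j k hjk
      have hdiff := hm_diff j k hjk
      have h₁ : (2 * m i : ℤ) ≠ m j - m k := fun h =>
        hdiff (by rw [← h, abs_of_nonneg (by positivity)])
      have h₂ : (2 * m i : ℤ) ≠ m k - m j := fun h =>
        hdiff (by rw [abs_sub_comm, ← h, abs_of_nonneg (by positivity)])
      rw [if_neg (by omega), if_neg (by omega), if_neg (by omega), if_neg (by omega),
        if_neg (by rintro ⟨rfl, rfl⟩; exact hjk rfl)]
      ring
  simp only [h_integrand]
  rw [intervalIntegral.integral_const_mul, intervalIntegral.integral_add,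
    intervalIntegral.integral_const_mul, integral_cos_int_harmonic hT0, if_neg hq,
    intervalIntegral.integral_finsetSum]
  · have hsum : ∀ j, ∫ t in (0:ℝ)..T, ∑ k, 1 / 2 * H j k *
          (Real.cos ((2 * m i : ℤ) * (2 * π / T) * t) *
          (((θhat j - θstar j) + a j * Real.sin ((m j : ℤ) * (2 * π / T) * t)) *
           ((θhat k - θstar k) + a k * Real.sin ((m k : ℤ) * (2 * π / T) * t))))
        = if j = i then -T / 8 * H i i * a i ^ 2 else 0 := by
      intro j
      rw [intervalIntegral.integral_finsetSum]
      · simp only [intervalIntegral.integral_const_mul,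
          integral_cos_mul_affine_sin_mul_affine_sin hT0 hq, hterm]
        split_ifs with hji
        · subst hji
          simp only [true_and, mul_ite, mul_zero, Finset.sum_ite_eq', Finset.mem_univ, if_true]
          ring
        · simp [hji]
      · intro k _
        exact Continuous.intervalIntegrable (by fun_prop) _ _
    simp only [hsum, Finset.sum_ite_eq', Finset.mem_univ, if_true]
    have := ha i
    field_simp
    ring
  · intro j _
    exact Continuous.intervalIntegrable (by fun_prop) _ _
  all_goals exact Continuous.intervalIntegrable (by fun_prop) _ _
end

section
/- Let θ̂ ∈ ℝ^n be fixed and let i ≠ j be fixed indices in {1,…,n}. Assume the positive integers m_1, …, m_n are pairwise distinct and that for every pair of indices (k, l) with {k, l} ≠ {i, j}: m_i + m_j ≠ m_k + m_l, m_i + m_j ≠ |m_k − m_l|, |m_i − m_j| ≠ m_k + m_l, and |m_i − m_j| ≠ |m_k − m_l|. Then (1/T) ∫₀^T (2/(a_i a_j)) [cos((ω_i − ω_j) t) − cos((ω_i + ω_j) t)] · y(θ̂ + S(t)) dt = H_{ij}; that is, demodulating the perturbed quadratic map with the signal N_{ij}(t) = (2/(a_i a_j))[cos((ω_i − ω_j)t)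 − cos((ω_i + ω_j)t)] and averaging over one period recovers exactly the (i,j) off-diagonal entry of the Hessian H, independently of θ̂. -/
open Real Matrix

/-- The integral over one period of the harmonic of integer order `p`. -/
lemma integral_cos_harmonic {T : ℝ} (hT : 0 < T) (p : ℤ) :
    ∫ t in (0:ℝ)..T, cos (2 * π * p / T * t) = if p = 0 then T else 0 := by
  split_ifs with hp
  · simp [hp]
  · have hc : 2 * π * p / T ≠ 0 := by
      have : (p : ℝ) ≠ 0 := by exact_mod_cast hp
      have := pi_pos.ne'
      have := hT.ne'
      positivity
    rw [intervalIntegral.integral_comp_mul_left (fun x => cos x) hc, integral_cos]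
    have h : 2 * π * p / T * T = p * (2 * π) := by field_simp
    have hs := sin_int_mul_two_pi_sub 0 p
    simp only [sub_zero, sin_zero, neg_zero] at hs
    simp [h, hs]

lemma integral_sin_harmonic {T : ℝ} (hT : 0 < T) (p : ℤ) :
    ∫ t in (0:ℝ)..T, sin (2 * π * p / T * t) = 0 := by
  by_cases hp : p = 0
  · simp [hp]
  · have hc : 2 * π * p / T ≠ 0 := by
      have : (p : ℝ) ≠ 0 := by exact_mod_cast hp
      have := pi_pos.ne'
      have := hT.ne'
      positivity
    rw [intervalIntegral.integral_comp_mul_left (fun x => sin x) hc, integral_sin]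
    have h : 2 * π * p / T * T = p * (2 * π) := by field_simp
    simp [h, cos_int_mul_two_pi]

lemma integral_cos_mul_cos_harmonic {T : ℝ} (hT : 0 < T) (p q : ℤ) :
    ∫ t in (0:ℝ)..T, cos (2 * π * p / T * t) * cos (2 * π * q / T * t)
      = ((if p = q then T else 0) + (if p = -q then T else 0)) / 2 := by
  have h : ∀ t : ℝ, cos (2 * π * p / T * t) * cos (2 * π * q / T * t)
      = (cos (2 * π * (p - q : ℤ) / T * t) + cos (2 * π * (p + q : ℤ) / T * t)) / 2 := by
    intro t
    have h₁ : 2 * π * (p - q : ℤ) / T * t = 2 * π * p / T * t - 2 * π * q / T * t := by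
      push_cast; ring
    have h₂ : 2 * π * (p + q : ℤ) / T * t = 2 * π * p / T * t + 2 * π * q / T * t := by
      push_cast; ring
    rw [h₁, h₂, cos_sub, cos_add]; ring
  simp_rw [h]
  rw [intervalIntegral.integral_div, intervalIntegral.integral_add
    (Continuous.intervalIntegrable (by fun_prop) _ _)
    (Continuous.intervalIntegrable (by fun_prop) _ _),
    integral_cos_harmonic hT, integral_cos_harmonic hT]
  simp only [sub_eq_zero, add_eq_zero_iff_eq_neg]

lemma integral_cos_mul_sin_harmonic {T : ℝ} (hT : 0 < T) (p q : ℤ) :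
    ∫ t in (0:ℝ)..T, cos (2 * π * p / T * t) * sin (2 * π * q / T * t) = 0 := by
  have h : ∀ t : ℝ, cos (2 * π * p / T * t) * sin (2 * π * q / T * t)
      = (sin (2 * π * (p + q : ℤ) / T * t) - sin (2 * π * (p - q : ℤ) / T * t)) / 2 := by
    intro t
    have h₁ : 2 * π * (p - q : ℤ) / T * t = 2 * π * p / T * t - 2 * π * q / T * t := by
      push_cast; ring
    have h₂ : 2 * π * (p + q : ℤ) / T * t = 2 * π * p / T * t + 2 * π * q / T * t := by
      push_cast; ring
    rw [h₁, h₂, sin_sub, sin_add]; ring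
  simp_rw [h]
  rw [intervalIntegral.integral_div, intervalIntegral.integral_sub
    (Continuous.intervalIntegrable (by fun_prop) _ _)
    (Continuous.intervalIntegrable (by fun_prop) _ _),
    integral_sin_harmonic hT, integral_sin_harmonic hT]
  simp

/-- Averaging a nonconstant harmonic against a product of two offset sinusoids only sees the
product of the oscillating parts. -/
lemma integral_cos_mul_offset_sin_mul_offset_sin {T : ℝ} (hT : 0 < T) {p : ℤ} (hp : p ≠ 0)
    (r s : ℤ) (u v α β : ℝ) :
    ∫ t in (0:ℝ)..T, cos (2 * π * p / T * t) *
        ((u + α * sin (2 * π * r / T * t)) * (v + β * sin (2 * π * s / T * t)))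
      = α * β / 4 * ((if p = r - s then T else 0) + (if p = -(r - s) then T else 0)
          - (if p = r + s then T else 0) - (if p = -(r + s) then T else 0)) := by
  have h : ∀ t : ℝ, cos (2 * π * p / T * t) *
        ((u + α * sin (2 * π * r / T * t)) * (v + β * sin (2 * π * s / T * t)))
      = u * v * cos (2 * π * p / T * t)
        + u * β * (cos (2 * π * p / T * t) * sin (2 * π * s / T * t))
        + v * α * (cos (2 * π * p / T * t) * sin (2 * π * r / T * t))
        + α * β / 2 * (cos (2 * π * p / T * t) * cos (2 * π * (r - s : ℤ) / T * t))
        - α * β / 2 * (cos (2 * π * p / T * t) * cos (2 * π * (r + s : ℤ) / T * t)) := by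
    intro t
    have h₁ : 2 * π * (r - s : ℤ) / T * t = 2 * π * r / T * t - 2 * π * s / T * t := by
      push_cast; ring
    have h₂ : 2 * π * (r + s : ℤ) / T * t = 2 * π * r / T * t + 2 * π * s / T * t := by
      push_cast; ring
    rw [h₁, h₂, cos_sub, cos_add]; ring
  simp_rw [h]
  rw [intervalIntegral.integral_sub, intervalIntegral.integral_add,
    intervalIntegral.integral_add, intervalIntegral.integral_add]
  · simp only [intervalIntegral.integral_const_mul, integral_cos_harmonic hT,
      integral_cos_mul_sin_harmonic hT, integral_cos_mul_cos_harmonic hT, if_neg hp]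
    ring
  all_goals exact Continuous.intervalIntegrable (by fun_prop) _ _

/-- Demodulating the perturbed quadratic map with the signal
`Nᵢⱼ(t) = (2/(aᵢaⱼ))[cos((ωᵢ−ωⱼ)t) − cos((ωᵢ+ωⱼ)t)]` and averaging over one period
recovers exactly the `(i,j)` off-diagonal entry of the Hessian `H`, independently of `θ̂`. -/
theorem hessian_offdiagonal_demodulation_exact
    (n : ℕ) (Qstar : ℝ) (θstar : Fin n → ℝ) (H : Matrix (Fin n) (Fin n) ℝ)
    (hH : H.IsSymm)
    (T : ℝ) (hT : 0 < T)
    (m : Fin n → ℕ) (hmpos : ∀ i, 0 < m i)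
    (hm_distinct : Function.Injective m)
    (a : Fin n → ℝ) (ha : ∀ i, a i ≠ 0)
    (ω : Fin n → ℝ) (hω : ∀ i, ω i = 2 * π * (m i : ℝ) / T)
    (S : ℝ → Fin n → ℝ) (hS : ∀ t i, S t i = a i * Real.sin (ω i * t))
    (y : (Fin n → ℝ) → ℝ)
    (hy : ∀ θ, y θ = Qstar + (1 / 2) * ((θ - θstar) ⬝ᵥ H.mulVec (θ - θstar)))
    (θhat : Fin n → ℝ) (i j : Fin n) (hij : i ≠ j)
    (hfreq : ∀ k l : Fin n, ({k, l} : Finset (Fin n)) ≠ ({i, j} : Finset (Fin n)) →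
      m i + m j ≠ m k + m l ∧
      ((m i : ℤ) + (m j : ℤ) ≠ |(m k : ℤ) - (m l : ℤ)|) ∧
      (|(m i : ℤ) - (m j : ℤ)| ≠ (m k : ℤ) + (m l : ℤ)) ∧
      (|(m i : ℤ) - (m j : ℤ)| ≠ |(m k : ℤ) - (m l : ℤ)|)) :
    (1 / T) * ∫ t in (0:ℝ)..T,
        (2 / (a i * a j)) * (Real.cos ((ω i - ω j) * t) - Real.cos ((ω i + ω j) * t))
          * y (θhat + S t)
      = H i j := by
  have hω' : ∀ k, ω k = 2 * π * ((m k : ℤ) : ℝ) / T := fun k => by rw [hω k]; simp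
  have hsub : ω i - ω j = 2 * π * ((m i - m j : ℤ) : ℝ) / T := by
    rw [hω, hω]; push_cast; ring
  have hadd : ω i + ω j = 2 * π * ((m i + m j : ℤ) : ℝ) / T := by
    rw [hω, hω]; push_cast; ring
  have hmij : m i ≠ m j := fun h => hij (hm_distinct h)
  have hi := hmpos i
  have hj := hmpos j
  have hp : (m i - m j : ℤ) ≠ 0 := by omega
  have hq : (m i + m j : ℤ) ≠ 0 := by omega
  have hpair : ∀ k l, ∫ t in (0:ℝ)..T, (cos ((ω i - ω j) * t) - cos ((ω i + ω j) * t)) *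
        ((θhat k - θstar k + a k * sin (ω k * t)) * (θhat l - θstar l + a l * sin (ω l * t)))
      = (if k = i then if l = j then a k * a l * T / 2 else 0 else 0)
        + (if k = j then if l = i then a k * a l * T / 2 else 0 else 0) := by
    intro k l
    have hk := hmpos k
    have hl := hmpos l
    simp_rw [sub_mul (cos _)]
    rw [intervalIntegral.integral_sub (Continuous.intervalIntegrable (by fun_prop) _ _)
      (Continuous.intervalIntegrable (by fun_prop) _ _), hsub, hadd, hω' k, hω' l,
      integral_cos_mul_offset_sin_mul_offset_sin hT hp,
      integral_cos_mul_offset_sin_mul_offset_sin hT hq]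
    by_cases h₁ : k = i ∧ l = j
    · obtain ⟨rfl, rfl⟩ := h₁
      rw [if_pos rfl, if_neg (by omega), if_neg (by omega), if_neg (by omega),
        if_neg (by omega), if_neg (by omega), if_pos rfl, if_neg (by omega),
        if_pos rfl, if_pos rfl, if_neg hij]
      ring
    by_cases h₂ : k = j ∧ l = i
    · obtain ⟨rfl, rfl⟩ := h₂
      rw [if_neg (by omega), if_pos (by omega), if_neg (by omega), if_neg (by omega),
        if_neg (by omega), if_neg (by omega), if_pos (by omega), if_neg (by omega),
        if_neg hij.symm, if_pos rfl, if_pos rfl]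
      ring
    have hne : ({k, l} : Finset (Fin n)) ≠ {i, j} := by
      intro h
      have hk : k ∈ ({i, j} : Finset (Fin n)) := h ▸ by simp
      have hi : i ∈ ({k, l} : Finset (Fin n)) := h ▸ by simp
      have hj : j ∈ ({k, l} : Finset (Fin n)) := h ▸ by simp
      simp only [Finset.mem_insert, Finset.mem_singleton] at hk hi hj
      rcases hk with hk | hk
      · exact h₁ ⟨hk, (hj.resolve_left fun e => hij (e.trans hk).symm).symm⟩
      · exact h₂ ⟨hk, (hi.resolve_left fun e => hij (e.trans hk)).symm⟩
    obtain ⟨f₁, f₂, f₃, f₄⟩ := hfreq k l hne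
    rw [abs_eq_max_neg] at f₂ f₃ f₄
    rw [abs_eq_max_neg] at f₄
    rw [if_neg (by omega), if_neg (by omega), if_neg (by omega), if_neg (by omega),
      if_neg (by omega), if_neg (by omega), if_neg (by omega), if_neg (by omega)]
    simp only [← ite_and, if_neg h₁, if_neg h₂]
    ring
  have hconst : ∫ t in (0:ℝ)..T, (cos ((ω i - ω j) * t) - cos ((ω i + ω j) * t)) = 0 := by
    rw [intervalIntegral.integral_sub (Continuous.intervalIntegrable (by fun_prop) _ _)
      (Continuous.intervalIntegrable (by fun_prop) _ _), hsub, hadd,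
      integral_cos_harmonic hT, integral_cos_harmonic hT, if_neg hp, if_neg hq, sub_zero]
  have hexpand : ∀ t, (2 / (a i * a j)) * (cos ((ω i - ω j) * t) - cos ((ω i + ω j) * t))
          * y (θhat + S t)
      = 2 / (a i * a j) * (Qstar * (cos ((ω i - ω j) * t) - cos ((ω i + ω j) * t))
        + 1 / 2 * ∑ k, ∑ l, H k l * ((cos ((ω i - ω j) * t) - cos ((ω i + ω j) * t)) *
        ((θhat k - θstar k + a k * sin (ω k * t)) *
          (θhat l - θstar l + a l * sin (ω l * t))))) := by
    intro t
    have hquad : (θhat + S t - θstar) ⬝ᵥ H.mulVec (θhat + S t - θstar)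
        = ∑ k, ∑ l, H k l * ((θhat k - θstar k + a k * sin (ω k * t)) *
          (θhat l - θstar l + a l * sin (ω l * t))) := by
      simp only [dotProduct, mulVec, Finset.mul_sum, Pi.sub_apply, Pi.add_apply, hS]
      refine Finset.sum_congr rfl fun k _ => Finset.sum_congr rfl fun l _ => ?_
      ring
    rw [hy, hquad, mul_assoc, mul_add]
    congr 2
    · ring
    · rw [mul_left_comm, Finset.mul_sum]
      simp only [Finset.mul_sum]
      refine Finset.sum_congr rfl fun k _ => Finset.sum_congr rfl fun l _ => ?_
      ring
  simp_rw [hexpand]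
  rw [intervalIntegral.integral_const_mul, intervalIntegral.integral_add
    (Continuous.intervalIntegrable (by fun_prop) _ _)
    (Continuous.intervalIntegrable (by fun_prop) _ _),
    intervalIntegral.integral_const_mul, hconst, intervalIntegral.integral_const_mul,
    intervalIntegral.integral_finsetSum
      fun k _ => Continuous.intervalIntegrable (by fun_prop) _ _]
  have hrow : ∀ k, ∫ t in (0:ℝ)..T, ∑ l, H k l *
        ((cos ((ω i - ω j) * t) - cos ((ω i + ω j) * t)) *
        ((θhat k - θstar k + a k * sin (ω k * t)) *
          (θhat l - θstar l + a l * sin (ω l * t))))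
      = (if k = i then H k j * (a k * a j * T / 2) else 0)
        + (if k = j then H k i * (a k * a i * T / 2) else 0) := by
    intro k
    rw [intervalIntegral.integral_finsetSum
      fun l _ => Continuous.intervalIntegrable (by fun_prop) _ _]
    simp only [intervalIntegral.integral_const_mul, hpair]
    simp only [mul_add, mul_ite, mul_zero, Finset.sum_add_distrib]
    congr 1 <;> split_ifs <;> simp
  simp only [hrow, Finset.sum_add_distrib, Finset.sum_ite_eq', Finset.mem_univ, if_true,
    hH.apply i j]
  have := ha i
  have := ha j
  field_simp
  ring
end

section
/- Let A be a real n×n matrix all of whose complex eigenvalues have strictly negative real part (i.e., A is Hurwitz). Then for every symmetric positive definite real n×n matrix Q there exists a symmetric positive definite real n×n matrix P satisfying the Lyapunov equation Aᵀ P + P A = −Q. -/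
open Matrix

open Filter Topology in
/-- Powers of an element of spectral radius less than one decay geometrically. -/
theorem eventually_norm_pow_le_of_spectralRadius_lt_one {A : Type*} [NormedRing A]
    [NormedAlgebra ℂ A] [CompleteSpace A] {a : A} (ha : spectralRadius ℂ a < 1) :
    ∃ r : ℝ, 0 ≤ r ∧ r < 1 ∧ ∀ᶠ k : ℕ in atTop, ‖a ^ k‖ ≤ r ^ k := by
  obtain ⟨r, har, hr⟩ := ENNReal.lt_iff_exists_nnreal_btwn.mp ha
  refine ⟨r, r.coe_nonneg, by exact_mod_cast hr, ?_⟩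
  filter_upwards [(spectrum.pow_nnnorm_pow_one_div_tendsto_nhds_spectralRadius a).eventually_lt_const
    har, eventually_gt_atTop 0] with k hk hk0
  have hk' : (0 : ℝ) < k := by exact_mod_cast hk0
  have h := ENNReal.rpow_le_rpow hk.le hk'.le
  rw [← ENNReal.rpow_mul, one_div_mul_cancel hk'.ne', ENNReal.rpow_one, ENNReal.rpow_natCast] at h
  exact_mod_cast h

section Stein

open scoped Matrix.Norms.Frobenius

variable {n : Type*} [Fintype n] [DecidableEq n]

/-- The series solving the Stein equation converges when `C` has its spectrum in the open unit
disc. -/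
theorem Matrix.summable_transpose_pow_mul_mul_pow {C : Matrix n n ℝ}
    (hC : ∀ z ∈ spectrum ℂ (C.map (algebraMap ℝ ℂ)), ‖z‖ < 1) (R : Matrix n n ℝ) :
    Summable fun k : ℕ ↦ Cᵀ ^ k * R * C ^ k := by
  have hrad : spectralRadius ℂ (C.map (algebraMap ℝ ℂ)) < 1 := by
    rcases (spectrum ℂ (C.map (algebraMap ℝ ℂ))).eq_empty_or_nonempty with h | h
    · rw [spectralRadius, h]
      simp
    · exact spectrum.spectralRadius_lt_of_forall_lt_of_nonempty h (r := 1) hC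
  obtain ⟨r, hr0, hr1, hr⟩ := eventually_norm_pow_le_of_spectralRadius_lt_one hrad
  refine .of_norm_bounded_eventually_nat (g := fun k ↦ ‖R‖ * (r ^ 2) ^ k)
    ((summable_geometric_of_lt_one (by positivity) (by nlinarith)).mul_left _) ?_
  filter_upwards [hr] with k hk
  have hnorm : ‖C ^ k‖ ≤ r ^ k := by
    have hmap : (C ^ k).map (algebraMap ℝ ℂ) = C.map (algebraMap ℝ ℂ) ^ k :=
      map_pow (algebraMap ℝ ℂ).mapMatrix C k
    rwa [← hmap, frobenius_norm_map_eq _ _ (fun a ↦ by simp)] at hk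
  calc ‖Cᵀ ^ k * R * C ^ k‖ ≤ ‖Cᵀ ^ k‖ * ‖R‖ * ‖C ^ k‖ :=
        (norm_mul_le _ _).trans (by gcongr; exact norm_mul_le _ _)
    _ = ‖C ^ k‖ * ‖R‖ * ‖C ^ k‖ := by rw [← transpose_pow, frobenius_norm_transpose]
    _ ≤ r ^ k * ‖R‖ * r ^ k := by gcongr
    _ = ‖R‖ * (r ^ 2) ^ k := by ring

/-- The Stein (discrete Lyapunov) equation is solvable when `C` has its spectrum in the open unit
disc. -/
theorem Matrix.exists_posDef_sub_transpose_mul_mul_eq {C R : Matrix n n ℝ}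
    (hC : ∀ z ∈ spectrum ℂ (C.map (algebraMap ℝ ℂ)), ‖z‖ < 1) (hR : R.PosDef) :
    ∃ P : Matrix n n ℝ, P.PosDef ∧ P - Cᵀ * P * C = R := by
  have hs := summable_transpose_pow_mul_mul_pow hC R
  have hpsd (k : ℕ) : (Cᵀ ^ k * R * C ^ k).PosSemidef := by
    simpa using hR.posSemidef.conjTranspose_mul_mul_same (C ^ k)
  set P := ∑' k : ℕ, Cᵀ ^ k * R * C ^ k with hP
  have hPsd : P.PosSemidef := by
    refine .of_dotProduct_mulVec_nonneg ?_ fun x ↦ ?_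
    · rw [IsHermitian, hP, conjTranspose_tsum]
      exact tsum_congr fun k ↦ (hpsd k).isHermitian
    · let q : Matrix n n ℝ →+ ℝ :=
        { toFun := fun M ↦ star x ⬝ᵥ (M *ᵥ x)
          map_zero' := by simp
          map_add' := fun M N ↦ by rw [add_mulVec, dotProduct_add] }
      have hq : Continuous q := by
        change Continuous fun M : Matrix n n ℝ ↦ star x ⬝ᵥ (M *ᵥ x)
        fun_prop
      exact (hs.hasSum.map q hq).nonneg fun k ↦ (hpsd k).dotProduct_mulVec_nonneg x
  have hstein : P = R + Cᵀ * P * C := by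
    rw [hP, ← hs.tsum_mul_left, ← (hs.mul_left _).tsum_mul_right, hs.tsum_eq_zero_add]
    congr 1
    · simp
    · refine tsum_congr fun k ↦ ?_
      rw [pow_succ', pow_succ]
      noncomm_ring
  refine ⟨P, ?_, by rw [sub_eq_iff_eq_add, ← hstein]⟩
  rw [hstein]
  exact hR.add_posSemidef (by simpa using hPsd.conjTranspose_mul_mul_same C)

end Stein

/-- The Möbius map `z ↦ (z - 1) / (z + 1)` sends the complement of the open unit disc to the closed
right half-plane. -/
theorem Complex.re_sub_one_div_add_one_nonneg {z : ℂ} (hz : 1 ≤ ‖z‖) :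
    0 ≤ ((z - 1) / (z + 1)).re := by
  have h : 1 ≤ z.re * z.re + z.im * z.im := by
    rw [← Complex.normSq_apply, Complex.normSq_eq_norm_sq]
    nlinarith
  rw [Complex.div_re, ← add_div]
  refine div_nonneg ?_ (Complex.normSq_nonneg _)
  simp
  nlinarith

/-- The Cayley transform of an element with spectrum in the open left half-plane has its spectrum
in the open unit disc. -/
theorem norm_lt_one_of_mem_spectrum_cayley {A : Type*} [Ring A] [Algebra ℂ A] {a b : A}
    (ha : ∀ z ∈ spectrum ℂ a, z.re < 0) (hab : (1 - a) * b = 1) (hba : b * (1 - a) = 1) :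
    ∀ z ∈ spectrum ℂ ((1 + a) * b), ‖z‖ < 1 := by
  intro z hz
  by_contra! hz1
  refine hz ?_
  have hb : IsUnit b := ⟨⟨b, 1 - a, hba, hab⟩, rfl⟩
  have hfactor : algebraMap ℂ A z - (1 + a) * b = ((z - 1) • (1 : A) - (z + 1) • a) * b := by
    calc algebraMap ℂ A z - (1 + a) * b = (z • ((1 - a) * b)) - (1 + a) * b := by
          rw [hab, Algebra.algebraMap_eq_smul_one]
      _ = (z • (1 - a) - (1 + a)) * b := by rw [sub_mul _ (1 + a), smul_mul_assoc]
      _ = _ := by congr 1; module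
  rw [spectrum.mem_resolventSet_iff, hfactor]
  refine IsUnit.mul ?_ hb
  by_cases h : z + 1 = 0
  · rw [h, zero_smul, sub_zero, ← Algebra.algebraMap_eq_smul_one]
    refine (IsUnit.mk0 (z - 1) fun h' ↦ ?_).map (algebraMap ℂ A)
    exact two_ne_zero (α := ℂ) (by linear_combination h - h')
  · have hmem : (z - 1) / (z + 1) ∉ spectrum ℂ a := fun hm ↦
      (ha _ hm).not_ge (Complex.re_sub_one_div_add_one_nonneg hz1)
    have hunit := ((IsUnit.mk0 _ h).map (algebraMap ℂ A)).mul (spectrum.notMem_iff.mp hmem)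
    convert hunit using 1
    rw [← Algebra.smul_def, Algebra.algebraMap_eq_smul_one, smul_sub, smul_smul,
      mul_div_cancel₀ _ h]

/-- If `A` is Hurwitz (all complex eigenvalues have strictly negative real part), then for
every symmetric positive definite `Q` there is a symmetric positive definite `P` solving the
Lyapunov equation `Aᵀ P + P A = −Q`. -/
theorem lyapunov_equation_solvable
    (n : ℕ) (A : Matrix (Fin n) (Fin n) ℝ)
    (hA : ∀ μ ∈ spectrum ℂ (A.map (algebraMap ℝ ℂ)), μ.re < 0) :
    ∀ Q : Matrix (Fin n) (Fin n) ℝ, Q.IsSymm → Q.PosDef →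
      ∃ P : Matrix (Fin n) (Fin n) ℝ, P.IsSymm ∧ P.PosDef ∧ Aᵀ * P + P * A = -Q := by
  intro Q _ hQ
  let f := (algebraMap ℝ ℂ).mapMatrix (m := Fin n)
  have hunit : IsUnit (1 - A) := by
    have h : IsUnit (f (1 - A)) := by
      have h1 : (1 : ℂ) ∉ spectrum ℂ (f A) := fun hm ↦ by
        have := hA 1 hm
        norm_num at this
      simpa using spectrum.notMem_iff.mp h1
    rw [isUnit_iff_isUnit_det, ← RingHom.map_det, isUnit_map_iff] at h
    rwa [isUnit_iff_isUnit_det]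
  obtain ⟨u, hu⟩ := hunit
  let B : Matrix (Fin n) (Fin n) ℝ := ↑u⁻¹
  have hAB : (1 - A) * B = 1 := by rw [← hu]; exact u.mul_inv
  have hBA : B * (1 - A) = 1 := by rw [← hu]; exact u.inv_mul
  have hC : ∀ z ∈ spectrum ℂ (((1 + A) * B).map (algebraMap ℝ ℂ)), ‖z‖ < 1 := by
    have h := norm_lt_one_of_mem_spectrum_cayley (a := f A) (b := f B) hA
      (by rw [← map_one f, ← map_sub, ← map_mul, hAB])
      (by rw [← map_one f, ← map_sub, ← map_mul, hBA])
    rwa [← map_one f, ← map_add, ← map_mul] at h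
  have hR : (Bᵀ * ((2 : ℝ) • Q) * B).PosDef := by
    have hinj : Function.Injective B.mulVec := mulVec_injective_of_isUnit u⁻¹.isUnit
    simpa using (hQ.smul (two_pos : (0 : ℝ) < 2)).conjTranspose_mul_mul_same hinj
  obtain ⟨P, hP, hstein⟩ := exists_posDef_sub_transpose_mul_mul_eq hC hR
  refine ⟨P, by simpa using hP.isHermitian, hP, ?_⟩
  have hBAt : (1 - A)ᵀ * Bᵀ = 1 := by rw [← transpose_mul, hBA, transpose_one]
  have hcayley : (1 - A)ᵀ * P * (1 - A) - (1 + A)ᵀ * P * (1 + A) = (2 : ℝ) • Q := by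
    calc (1 - A)ᵀ * P * (1 - A) - (1 + A)ᵀ * P * (1 + A)
        = (1 - A)ᵀ * P * (1 - A)
          - ((1 - A)ᵀ * Bᵀ) * (1 + A)ᵀ * P * (1 + A) * (B * (1 - A)) := by
            rw [hBAt, hBA, one_mul, mul_one]
      _ = (1 - A)ᵀ * (P - ((1 + A) * B)ᵀ * P * ((1 + A) * B)) * (1 - A) := by
            rw [transpose_mul]
            noncomm_ring
      _ = ((1 - A)ᵀ * Bᵀ) * ((2 : ℝ) • Q) * (B * (1 - A)) := by
            rw [hstein]
            simp only [mul_assoc]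
      _ = (2 : ℝ) • Q := by rw [hBAt, hBA, one_mul, mul_one]
  have htwo : (2 : ℝ) • (Aᵀ * P + P * A) = (2 : ℝ) • -Q := by
    rw [smul_neg, ← hcayley, transpose_sub, transpose_add, transpose_one, two_smul]
    noncomm_ring
  exact smul_right_injective _ two_ne_zero htwo
end

section
/- Let c > 0 and let V : [0, ∞) → ℝ be continuous with V(t) ≥ 0 for all t, differentiable at every t with V(t) > 0, and satisfying V′(t) ≤ −c √(V(t)) at every such t. Then √(V(t)) ≤ max(√(V(0)) − (c/2) t, 0) for all t ≥ 0; in particular V(t) = 0 for every t ≥ 2√(V(0))/c, and once V vanishes it remains zero for all later times. -/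
/-- On an interval whose interior lies in the positivity set of `V`, the square root of `V`
decreases at rate at least `c / 2`. -/
theorem sqrt_add_le_of_pos_on_Ioo
    {c : ℝ} {V : ℝ → ℝ}
    (hcont : ContinuousOn V (Set.Ici (0:ℝ)))
    (hdiff : ∀ t, 0 ≤ t → 0 < V t → DifferentiableAt ℝ V t)
    (hderiv : ∀ t, 0 ≤ t → 0 < V t → deriv V t ≤ -c * Real.sqrt (V t))
    {r t : ℝ} (hr : 0 ≤ r) (hrt : r ≤ t) (hpos : ∀ x ∈ Set.Ioo r t, 0 < V x) :
    Real.sqrt (V t) + c / 2 * t ≤ Real.sqrt (V r) + c / 2 * r := by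
  have key : ∀ x ∈ Set.Ioo r t, HasDerivAt (fun x => Real.sqrt (V x) + c / 2 * x)
      (deriv V x / (2 * Real.sqrt (V x)) + c / 2) x := by
    intro x hx
    have hV := hpos x hx
    have h := (hdiff x (hr.trans hx.1.le) hV).hasDerivAt.sqrt hV.ne'
    simpa using h.fun_add ((hasDerivAt_id x).const_mul (c / 2))
  have hanti : AntitoneOn (fun x => Real.sqrt (V x) + c / 2 * x) (Set.Icc r t) := by
    refine antitoneOn_of_deriv_nonpos (convex_Icc r t) ?_ ?_ ?_
    · have hV : ContinuousOn V (Set.Icc r t) := hcont.mono fun x hx => hr.trans hx.1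
      exact hV.sqrt.add (by fun_prop)
    · rw [interior_Icc]
      exact fun x hx => (key x hx).differentiableAt.differentiableWithinAt
    · rw [interior_Icc]
      intro x hx
      rw [(key x hx).deriv]
      have hV := hpos x hx
      have hs : 0 < Real.sqrt (V x) := Real.sqrt_pos.2 hV
      have hle : deriv V x / (2 * Real.sqrt (V x)) ≤ -(c / 2) := by
        rw [div_le_iff₀ (by positivity)]
        linarith [hderiv x (hr.trans hx.1.le) hV]
      linarith
  exact hanti (Set.left_mem_Icc.2 hrt) (Set.right_mem_Icc.2 hrt) hrt

/-- If `V` vanishes at `s`, it vanishes at every later time. -/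
theorem eq_zero_of_le_of_eq_zero
    {c : ℝ} (hc : 0 < c) {V : ℝ → ℝ}
    (hcont : ContinuousOn V (Set.Ici (0:ℝ)))
    (hnonneg : ∀ t, 0 ≤ t → 0 ≤ V t)
    (hdiff : ∀ t, 0 ≤ t → 0 < V t → DifferentiableAt ℝ V t)
    (hderiv : ∀ t, 0 ≤ t → 0 < V t → deriv V t ≤ -c * Real.sqrt (V t))
    {s t : ℝ} (hs : 0 ≤ s) (hst : s ≤ t) (hVs : V s = 0) : V t = 0 := by
  have hclosed : IsClosed (Set.Icc s t ∩ V ⁻¹' {0}) :=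
    (hcont.mono fun x hx => hs.trans hx.1).preimage_isClosed_of_isClosed
      isClosed_Icc isClosed_singleton
  have hcompact : IsCompact (Set.Icc s t ∩ V ⁻¹' {0}) :=
    isCompact_Icc.of_isClosed_subset hclosed Set.inter_subset_left
  obtain ⟨r, ⟨hr, hVr⟩, hmax⟩ :=
    hcompact.exists_isGreatest ⟨s, Set.left_mem_Icc.2 hst, hVs⟩
  have hr0 : 0 ≤ r := hs.trans hr.1
  have hpos : ∀ x ∈ Set.Ioo r t, 0 < V x := by
    intro x hx
    refine (hnonneg x (hr0.trans hx.1.le)).lt_of_ne' fun hVx => ?_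
    exact hx.1.not_ge (hmax ⟨⟨hr.1.trans hx.1.le, hx.2.le⟩, hVx⟩)
  have h := sqrt_add_le_of_pos_on_Ioo hcont hdiff hderiv hr0 hr.2 hpos
  have hVr' : V r = 0 := hVr
  rw [hVr', Real.sqrt_zero] at h
  have hmul : c / 2 * r ≤ c / 2 * t := mul_le_mul_of_nonneg_left hr.2 (by positivity)
  exact (Real.sqrt_eq_zero (hnonneg t (hs.trans hst))).1
    (le_antisymm (by linarith) (Real.sqrt_nonneg _))


/-- Finite-time comparison lemma: a nonnegative continuous scalar function on `[0,∞)`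
whose derivative satisfies `V′ ≤ −c√V` wherever `V > 0` obeys
`√(V(t)) ≤ max(√(V(0)) − (c/2)t, 0)`; in particular `V(t) = 0` for all
`t ≥ 2√(V(0))/c`, and once `V` vanishes it stays zero. -/
theorem finite_time_comparison_lemma
    (c : ℝ) (hc : 0 < c)
    (V : ℝ → ℝ)
    (hcont : ContinuousOn V (Set.Ici (0:ℝ)))
    (hnonneg : ∀ t, 0 ≤ t → 0 ≤ V t)
    (hdiff : ∀ t, 0 ≤ t → 0 < V t → DifferentiableAt ℝ V t)
    (hderiv : ∀ t, 0 ≤ t → 0 < V t → deriv V t ≤ -c * Real.sqrt (V t)) :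
    (∀ t, 0 ≤ t → Real.sqrt (V t) ≤ max (Real.sqrt (V 0) - (c / 2) * t) 0) ∧
    (∀ t, 2 * Real.sqrt (V 0) / c ≤ t → V t = 0) ∧
    (∀ s t, 0 ≤ s → s ≤ t → V s = 0 → V t = 0) := by
  have hzero : ∀ s t, 0 ≤ s → s ≤ t → V s = 0 → V t = 0 := fun s t hs hst hVs =>
    eq_zero_of_le_of_eq_zero hc hcont hnonneg hdiff hderiv hs hst hVs
  have hbound : ∀ t, 0 ≤ t → Real.sqrt (V t) ≤ max (Real.sqrt (V 0) - (c / 2) * t) 0 := by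
    intro t ht
    by_cases hVt : V t = 0
    · simp [hVt]
    · have hpos : ∀ x ∈ Set.Ioo 0 t, 0 < V x := fun x hx =>
        (hnonneg x hx.1.le).lt_of_ne' fun hVx => hVt (hzero x t hx.1.le hx.2.le hVx)
      have h := sqrt_add_le_of_pos_on_Ioo hcont hdiff hderiv le_rfl ht hpos
      exact le_max_of_le_left (by linarith)
  refine ⟨hbound, fun t ht => ?_, hzero⟩
  have ht0 : 0 ≤ t := le_trans (by positivity) ht
  have hle : Real.sqrt (V 0) - (c / 2) * t ≤ 0 := by
    rw [div_le_iff₀ hc] at ht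
    linarith
  have h := hbound t ht0
  rw [max_eq_right hle] at h
  exact (Real.sqrt_eq_zero (hnonneg t ht0)).1 (le_antisymm h (Real.sqrt_nonneg _))
end
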